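/- Let λ_1, λ_2, λ_3 be positive integers with λ_1 = max{λ_1, λ_2, λ_3} and λ_1 < λ_2 + λ_3. Then the sun graph S(3; λ_1, λ_2, λ_3) has no connected partition of type (λ_2 + λ_3 + 1, λ_1 + 2), and hence is not e-positive. -/

import Mathlib

noncomputable section

open SimpleGraph

/-- The chromatic symmetric function of a finite simple graph, as a formal power
series in countably many commuting variables `x_0, x_1, x_2, …`: the coefficient of the
monomial `∏ i, x_i ^ d i` is the number of proper colourings `κ : V → ℕ` in which colour `i`
is used exactly `d i` times. -/
def csf {V : Type} [Fintype V] (G : SimpleGraph V) : MvPowerSeries ℕ ℚ :=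
  fun d => (Nat.card {κ : V → ℕ //
      (∀ u v : V, G.Adj u v → κ u ≠ κ v) ∧
      ∀ i : ℕ, Nat.card {v : V // κ v = i} = d i} : ℚ)

/-- The elementary symmetric function `e_k` as a formal power series. -/
def esym (k : ℕ) : MvPowerSeries ℕ ℚ :=
  fun d => if (∀ i ∈ d.support, d i = 1) ∧ (d.sum fun _ v => v) = k then 1 else 0

/-- `e_λ` for a partition `λ` given as a multiset of parts. -/
def esymM (μ : Multiset ℕ) : MvPowerSeries ℕ ℚ :=
  (μ.map esym).prod

/-- A symmetric function is `e`-positive if it is a finite nonnegative linear combination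
of the elementary symmetric functions `e_λ`, `λ` a partition (all parts positive). -/
def EPositive (f : MvPowerSeries ℕ ℚ) : Prop :=
  ∃ c : Multiset ℕ →₀ ℚ, (∀ μ, 0 ≤ c μ) ∧ (∀ μ ∈ c.support, 0 ∉ μ) ∧
    f = c.sum fun μ a => a • esymM μ

/-- The path `P_k` on `k` vertices. -/
def pathG (k : ℕ) : SimpleGraph (Fin k) :=
  SimpleGraph.fromRel (fun i j => (j : ℕ) = (i : ℕ) + 1)

/-- The cycle `C_m` on `m` vertices (for `m = 2` this is a single edge, i.e. `P_2`). -/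
def cycleG (m : ℕ) : SimpleGraph (Fin m) :=
  SimpleGraph.fromRel (fun i j => (j : ℕ) = ((i : ℕ) + 1) % m)

/-- Auxiliary relation for sun graphs: body relation on `Fin n`, plus rays
`P_{lam i}` attached at vertex `i`, the leaf `⟨i,0⟩` of ray `i` being joined to `i`. -/
def sunRel (n : ℕ) (lam : Fin n → ℕ) (body : Fin n → Fin n → Prop) :
    (Fin n ⊕ ((i : Fin n) × Fin (lam i))) → (Fin n ⊕ ((i : Fin n) × Fin (lam i))) → Prop
  | Sum.inl i, Sum.inl i' => body i i'
  | Sum.inl i, Sum.inr p => p.1 = i ∧ (p.2 : ℕ) = 0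
  | Sum.inr p, Sum.inr q => p.1 = q.1 ∧ (q.2 : ℕ) = (p.2 : ℕ) + 1
  | _, _ => False

/-- The sun graph `S(n; λ_1, …, λ_n)`: a cycle `C_n` with a path `P_{λ_i}` (a *ray*)
joined by an edge to the `i`-th cycle vertex, for each `i`. -/
def sunGraph (n : ℕ) (lam : Fin n → ℕ) :
    SimpleGraph (Fin n ⊕ ((i : Fin n) × Fin (lam i))) :=
  SimpleGraph.fromRel (sunRel n lam (fun i i' => (i' : ℕ) = ((i : ℕ) + 1) % n))

/-- The complete sun graph `S̄(n; λ_1, …, λ_n)`: as `sunGraph`, but with complete body `K_n`. -/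
def completeSunGraph (n : ℕ) (lam : Fin n → ℕ) :
    SimpleGraph (Fin n ⊕ ((i : Fin n) × Fin (lam i))) :=
  SimpleGraph.fromRel (sunRel n lam (fun i i' => i ≠ i'))

/-- The spider `S(μ_1, …, μ_d)`: `d` paths (legs) `P_{μ_i}`, each joined at a leaf to a
common centre vertex. -/
def spiderGraph (d : ℕ) (mu : Fin d → ℕ) :
    SimpleGraph (Unit ⊕ ((i : Fin d) × Fin (mu i))) :=
  SimpleGraph.fromRel (fun a b => match a, b with
    | Sum.inl _, Sum.inr p => (p.2 : ℕ) = 0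
    | Sum.inr p, Sum.inr q => p.1 = q.1 ∧ (q.2 : ℕ) = (p.2 : ℕ) + 1
    | _, _ => False)

/-- The graph obtained from a body graph `H` on `Fin n` by joining each body vertex `i`
by an edge to a chosen vertex `u i` of a graph `Gs i`. -/
def attachGraph {n : ℕ} {Vs : Fin n → Type} (H : SimpleGraph (Fin n))
    (Gs : ∀ i, SimpleGraph (Vs i)) (u : ∀ i, Vs i) :
    SimpleGraph (Fin n ⊕ ((i : Fin n) × Vs i)) :=
  SimpleGraph.fromRel (fun a b => match a, b with
    | Sum.inl i, Sum.inl i' => H.Adj i i'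
    | Sum.inl i, Sum.inr p => p.1 = i ∧ p.2 = u p.1
    | Sum.inr p, Sum.inr q => ∃ h : p.1 = q.1, (Gs q.1).Adj (h ▸ p.2) q.2
    | _, _ => False)

/-- `G` has a connected partition of type `μ`: a partition of the vertex set all of whose
blocks induce connected subgraphs, the multiset of block sizes being `μ`. -/
def HasConnectedPartition {V : Type} [Fintype V] [DecidableEq V]
    (G : SimpleGraph V) (μ : Multiset ℕ) : Prop :=
  ∃ P : Finpartition (Finset.univ : Finset V),
    (∀ p ∈ P.parts, (G.induce (↑p : Set V)).Connected) ∧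
      P.parts.val.map Finset.card = μ

/-- `G` has a perfect matching: a partition of `V(G)` into pairs of adjacent vertices. -/
def HasPerfectMatching {V : Type} (G : SimpleGraph V) : Prop :=
  ∃ M : G.Subgraph, M.IsPerfectMatching

/-- `G` has an almost perfect matching: a partition of `V(G)` into pairs of adjacent
vertices together with one singleton. -/
def HasAlmostPerfectMatching {V : Type} (G : SimpleGraph V) : Prop :=
  ∃ M : G.Subgraph, M.IsMatching ∧ ∃ v : V, M.verts = {v}ᶜ

/-- The tadpole graph `T_{m,l}`: the cycle `C_m` (vertices `0, …, m-1`, consecutive edges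
plus the chord `{0, m-1}`) with a path on `l` further vertices attached by an edge at
vertex `m-1`.  For `l = 0` this is just `C_m`. -/
def tadpole (m l : ℕ) : SimpleGraph (Fin (m + l)) :=
  SimpleGraph.fromRel (fun i j =>
    (j : ℕ) = (i : ℕ) + 1 ∨ ((i : ℕ) = 0 ∧ (j : ℕ) = m - 1))

/-- Dumbbell with path-parameter `t = l + 1 ≥ 0`: vertices `0, …, m-1` form the cycle `C_m`
(consecutive edges plus chord `{0, m-1}`), vertices `m+t-1, …, m+n+t-2` form the cycle `C_n`
(consecutive edges plus chord `{m+t-1, m+n+t-2}`), and the vertices in between form the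
connecting path; for `t = 0` (i.e. `l = -1`) the two cycles share the vertex `m-1`. -/
def dumbbellAux (m n t : ℕ) : SimpleGraph (Fin (m + n + t - 1)) :=
  SimpleGraph.fromRel (fun i j =>
    (j : ℕ) = (i : ℕ) + 1
      ∨ ((i : ℕ) = 0 ∧ (j : ℕ) = m - 1)
      ∨ ((i : ℕ) = m + t - 1 ∧ (j : ℕ) = m + n + t - 2))

/-- The dumbbell graph `D(m, l, n)` for `l ≥ -1`: cycles `C_m` and `C_n` joined by a path
on `l` vertices (for `l = 1` a single joining vertex, for `l = 0` a joining edge, and for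
`l = -1` the two cycles share a vertex). -/
def dumbbell (m n : ℕ) (l : ℤ) : SimpleGraph (Fin (m + n + (l + 1).toNat - 1)) :=
  dumbbellAux m n (l + 1).toNat

end

/-- An induced subgraph that is connected and meets both `T` and its complement contains an
edge leaving `T`. -/
theorem exists_adj_of_induce_preconnected {V : Type} {G : SimpleGraph V} {S : Set V}
    (hS : (G.induce S).Preconnected) (T : Set V) {x y : V} (hx : x ∈ S) (hxT : x ∈ T)
    (hy : y ∈ S) (hyT : y ∉ T) :
    ∃ u ∈ S, ∃ w ∈ S, u ∈ T ∧ w ∉ T ∧ G.Adj u w := by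
  obtain ⟨p⟩ := hS ⟨x, hx⟩ ⟨y, hy⟩
  obtain ⟨d, -, h₁, h₂⟩ := p.exists_boundary_dart {z | (z : V) ∈ T} hxT hyT
  exact ⟨d.fst, d.fst.2, d.snd, d.snd.2, h₁, h₂, d.adj⟩

/-- The only neighbour of a ray outside that ray is the body vertex it is attached to. -/
theorem sunGraph_adj_inr {n : ℕ} {lam : Fin n → ℕ} {i : Fin n} {k : Fin (lam i)}
    {w : Fin n ⊕ ((i : Fin n) × Fin (lam i))}
    (h : (sunGraph n lam).Adj (Sum.inr ⟨i, k⟩) w) (hw : ∀ k', w ≠ Sum.inr ⟨i, k'⟩) :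
    w = Sum.inl i := by
  rw [sunGraph, SimpleGraph.fromRel_adj] at h
  obtain ⟨-, h⟩ := h
  rcases w with j | ⟨j, k'⟩
  · simp only [sunRel, false_or] at h
    rw [h.1]
  · simp only [sunRel] at h
    have hij : i = j := by rcases h with h | h <;> simp [h.1]
    subst hij
    exact absurd rfl (hw k')

/-- A connected vertex set that meets a ray but avoids the body vertex of that ray has at most
as many elements as the ray. -/
theorem card_le_of_inl_notMem {n : ℕ} {lam : Fin n → ℕ}
    {A : Finset (Fin n ⊕ ((i : Fin n) × Fin (lam i)))}
    (hA : ((sunGraph n lam).induce (↑A : Set _)).Connected) {i : Fin n}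
    (hi : Sum.inl i ∉ A) {k : Fin (lam i)} (hk : Sum.inr ⟨i, k⟩ ∈ A) : A.card ≤ lam i := by
  have hsub : A ⊆ Finset.univ.map
      ⟨fun k : Fin (lam i) => (Sum.inr ⟨i, k⟩ : Fin n ⊕ ((i : Fin n) × Fin (lam i))),
        fun a b h => by simpa using h⟩ := by
    intro y hy
    by_contra hyn
    obtain ⟨u, -, w, hw, ⟨k', rfl⟩, hwT, huw⟩ := exists_adj_of_induce_preconnected
      hA.preconnected (Set.range fun k : Fin (lam i) => Sum.inr ⟨i, k⟩) (x := Sum.inr ⟨i, k⟩)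
      (y := y) hk ⟨k, rfl⟩ hy (by
        rintro ⟨k', rfl⟩
        exact hyn (Finset.mem_map_of_mem _ (Finset.mem_univ k')))
    have := sunGraph_adj_inr huw (fun k' h => hwT ⟨k', h.symm⟩)
    subst this
    exact hi hw
  simpa using Finset.card_le_card hsub

/-- If a vertex set and its complement are both connected and larger than every ray, the set
consists of full rays together with their body vertices. -/
theorem card_eq_sum_rays {n : ℕ} {lam : Fin n → ℕ}
    {A : Finset (Fin n ⊕ ((i : Fin n) × Fin (lam i)))}
    (hA : ((sunGraph n lam).induce (↑A : Set _)).Connected)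
    (hA' : ((sunGraph n lam).induce (↑Aᶜ : Set _)).Connected)
    (h : ∀ i, lam i < A.card) (h' : ∀ i, lam i < Aᶜ.card) :
    A.card = ∑ i, if Sum.inl i ∈ A then lam i + 1 else 0 := by
  have hray : ∀ i (k : Fin (lam i)), Sum.inr ⟨i, k⟩ ∈ A ↔ Sum.inl i ∈ A := by
    intro i k
    by_contra hne
    by_cases hi : Sum.inl i ∈ A
    · have hk : Sum.inr ⟨i, k⟩ ∈ Aᶜ := by simp_all
      exact (h' i).not_ge (card_le_of_inl_notMem hA' (by simpa using hi) hk)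
    · exact (h i).not_ge (card_le_of_inl_notMem hA hi (k := k) (by tauto))
  calc A.card = ∑ x, if x ∈ A then 1 else 0 := by simp
    _ = _ := by
      rw [Fintype.sum_sum_type, Fintype.sum_sigma, ← Finset.sum_add_distrib]
      refine Finset.sum_congr rfl fun i _ => ?_
      simp only [hray]
      split_ifs <;> simp [add_comm]

/-- A connected partition with two blocks consists of a vertex set and its complement. -/
theorem HasConnectedPartition.exists_compl {V : Type} [Fintype V] [DecidableEq V]
    {G : SimpleGraph V} {a b : ℕ} (h : HasConnectedPartition G {a, b}) :
    ∃ A : Finset V, A.card = a ∧ Aᶜ.card = b ∧ (G.induce (↑A : Set V)).Connected ∧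
      (G.induce (↑Aᶜ : Set V)).Connected := by
  obtain ⟨P, hP, hcard⟩ := h
  obtain ⟨A, B, hval, rfl, rfl⟩ : ∃ A B, P.parts.val = {A, B} ∧ A.card = a ∧ B.card = b := by
    have h2 : Multiset.card P.parts.val = 2 := by
      rw [← Multiset.card_map Finset.card, hcard]; rfl
    obtain ⟨A, B, hAB⟩ := Multiset.card_eq_two.1 h2
    rw [hAB] at hcard
    simp only [Multiset.insert_eq_cons, Multiset.map_cons, Multiset.map_singleton,
      Multiset.cons_eq_cons, Multiset.singleton_inj] at hcard
    rcases hcard with ⟨h₁, h₂⟩ | ⟨-, cs, h₁, h₂⟩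
    · exact ⟨A, B, hAB, h₁, h₂⟩
    · refine ⟨B, A, by rw [hAB]; exact Multiset.pair_comm A B, ?_, ?_⟩
      · exact (Multiset.singleton_eq_cons_iff _).1 h₁ |>.1
      · exact ((Multiset.singleton_eq_cons_iff _).1 h₂ |>.1).symm
  have hne : A ≠ B := by
    have := P.parts.nodup
    rw [hval] at this
    simpa using this
  have hA : A ∈ P.parts := by rw [Finset.mem_def, hval]; simp
  have hB : B ∈ P.parts := by rw [Finset.mem_def, hval]; simp
  have hmem : ∀ C ∈ P.parts, C = A ∨ C = B := by
    intro C hC; rw [Finset.mem_def, hval] at hC; simpa using hC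
  have hBA : Aᶜ = B := by
    ext v
    obtain ⟨C, hC, hv⟩ := P.exists_mem (Finset.mem_univ v)
    have hdis := Finset.disjoint_left.1 (P.disjoint hA hB hne)
    have := @hdis v
    rcases hmem C hC with rfl | rfl <;> simp_all
  refine ⟨A, rfl, by rw [hBA], hP A hA, ?_⟩
  rw [← hBA] at hB
  exact hP _ hB

theorem sun3_no_connected_compl {l₁ l₂ l₃ : ℕ} (h₂ : 0 < l₂) (h₃ : 0 < l₃)
    (hmax₂ : l₂ ≤ l₁) (hmax₃ : l₃ ≤ l₁) (hlt : l₁ < l₂ + l₃)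
    {A : Finset (Fin 3 ⊕ ((i : Fin 3) × Fin (![l₁, l₂, l₃] i)))}
    (hcard : A.card = l₂ + l₃ + 1) (hcard' : Aᶜ.card = l₁ + 2)
    (hA : ((sunGraph 3 ![l₁, l₂, l₃]).induce (↑A : Set _)).Connected)
    (hA' : ((sunGraph 3 ![l₁, l₂, l₃]).induce (↑Aᶜ : Set _)).Connected) : False := by
  have h := card_eq_sum_rays hA hA'
    (by rw [Fin.forall_fin_succ, Fin.forall_fin_two]; simp; omega)
    (by rw [Fin.forall_fin_succ, Fin.forall_fin_two]; simp; omega)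
  rw [hcard, Fin.sum_univ_three] at h
  simp only [Matrix.cons_val] at h
  split_ifs at h <;> omega

/-- The chromatic polynomial of a finite graph exists; here its variable is negated. -/
theorem exists_chromatic_polynomial {V : Type} [Finite V] (G : SimpleGraph V) :
    ∃ p : Polynomial ℚ, ∀ m : ℕ, p.eval (-(m : ℚ)) = Nat.card (G.Coloring (Fin m)) := by
  classical
  have : Finite (Setoid V) := Finite.of_injective (fun r : Setoid V => r.r)
    (fun r s h => Setoid.ext fun a b => by rw [show r a b = s a b from congrFun₂ h a b])
  let I := {r : Setoid V // ∀ u v, G.Adj u v → ¬ r u v}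
  have : Fintype I := Fintype.ofFinite _
  have hq : ∀ r : I, Fintype (Quotient r.1) := fun r => Fintype.ofFinite _
  refine ⟨∑ r : I, (descPochhammer ℚ (Fintype.card (Quotient r.1))).comp (-Polynomial.X),
    fun m => ?_⟩
  have hbij : Function.Bijective
      (fun x : (r : I) × (Quotient r.1 ↪ Fin m) =>
        (SimpleGraph.Coloring.mk (fun v => x.2 (Quotient.mk x.1.1 v)) (by
          intro u v huv h
          exact x.1.2 u v huv (Quotient.exact (x.2.injective h))) : G.Coloring (Fin m))) := by
    constructor
    · rintro ⟨⟨r, hr⟩, e⟩ ⟨⟨s, hs⟩, f⟩ h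
      have h' : ∀ v, e (Quotient.mk r v) = f (Quotient.mk s v) := fun v => DFunLike.congr_fun h v
      have hrs : r = s := by
        ext u v
        rw [← Quotient.eq (r := r), ← Quotient.eq (r := s), ← e.injective.eq_iff,
          ← f.injective.eq_iff, h', h']
      subst hrs
      have : e = f := by
        ext q
        induction q using Quotient.inductionOn with
        | h v => rw [h']
      rw [this]
    · intro κ
      refine ⟨⟨⟨Setoid.ker κ, fun u v huv h => κ.valid huv h⟩,
        ⟨Setoid.kerLift κ, Setoid.kerLift_injective κ⟩⟩, ?_⟩
      ext v
      rfl
  rw [← Nat.card_eq_of_bijective _ hbij, Nat.card_sigma, Polynomial.eval_finsetSum]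
  push_cast
  refine Finset.sum_congr rfl fun r _ => ?_
  rw [Nat.card_eq_fintype_card, Fintype.card_embedding_eq]
  simp [Polynomial.eval_comp, descPochhammer_eval_eq_descFactorial]

theorem polynomial_eq_of_eval_neg_natCast {p q : Polynomial ℚ}
    (h : ∀ m : ℕ, p.eval (-(m : ℚ)) = q.eval (-(m : ℚ))) : p = q := by
  refine Polynomial.eq_of_infinite_eval_eq _ _ (Set.Infinite.mono ?_
    (Set.infinite_range_of_injective (f := fun m : ℕ => -(m : ℚ)) ?_))
  · rintro _ ⟨m, rfl⟩
    exact h m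
  · intro a b h
    simpa using h

theorem bivariate_eq_of_eval_neg_natCast {p q : Polynomial (Polynomial ℚ)}
    (h : ∀ m n : ℕ, p.evalEval (-(m : ℚ)) (-(n : ℚ)) = q.evalEval (-(m : ℚ)) (-(n : ℚ))) :
    p = q := by
  refine Polynomial.eq_of_infinite_eval_eq _ _ (Set.Infinite.mono ?_
    (Set.infinite_range_of_injective (f := fun m : ℕ => Polynomial.C (-(m : ℚ))) ?_))
  · rintro _ ⟨n, rfl⟩
    exact polynomial_eq_of_eval_neg_natCast fun m => h m n
  · intro a b h
    simpa using h

theorem chromatic_polynomial_coeff_zero {V : Type} [Nonempty V] {G : SimpleGraph V}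
    {p : Polynomial ℚ} (hp : ∀ m : ℕ, p.eval (-(m : ℚ)) = Nat.card (G.Coloring (Fin m))) :
    p.coeff 0 = 0 := by
  have : IsEmpty (G.Coloring (Fin 0)) :=
    ⟨fun κ => (κ (Classical.arbitrary V)).elim0⟩
  have h := hp 0
  rw [Nat.card_of_isEmpty] at h
  simpa [Polynomial.coeff_zero_eq_eval_zero] using h

/-- The chromatic polynomial of a disconnected graph has no linear term. -/
theorem chromatic_polynomial_coeff_one {V : Type} [Finite V] [Nonempty V] {G : SimpleGraph V}
    (hG : ¬ G.Connected) {p : Polynomial ℚ}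
    (hp : ∀ m : ℕ, p.eval (-(m : ℚ)) = Nat.card (G.Coloring (Fin m))) :
    p.coeff 1 = 0 := by
  classical
  obtain ⟨u, v, huv⟩ : ∃ u v, ¬ G.Reachable u v := by
    by_contra! h
    exact hG ⟨h⟩
  let S : Set V := {w | G.Reachable u w}
  have hS : ∀ x y, G.Adj x y → (x ∈ S ↔ y ∈ S) := fun x y h =>
    ⟨fun hx => hx.trans h.reachable, fun hy => hy.trans h.symm.reachable⟩
  obtain ⟨q, hq⟩ := exists_chromatic_polynomial (G.induce S)
  obtain ⟨r, hr⟩ := exists_chromatic_polynomial (G.induce Sᶜ)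
  have : Nonempty S := ⟨⟨u, SimpleGraph.Reachable.refl u⟩⟩
  have : Nonempty ↑Sᶜ := ⟨⟨v, huv⟩⟩
  have hpqr : p = q * r := by
    refine polynomial_eq_of_eval_neg_natCast fun m => ?_
    rw [Polynomial.eval_mul, hp, hq, hr, ← Nat.cast_mul, ← Nat.card_prod]
    congr 1
    refine Nat.card_congr
      { toFun := fun κ => (SimpleGraph.Coloring.mk (fun x => κ x) fun h => κ.valid h,
          SimpleGraph.Coloring.mk (fun x => κ x) fun h => κ.valid h)
        invFun := fun κ => SimpleGraph.Coloring.mk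
          (fun x => if h : x ∈ S then κ.1 ⟨x, h⟩ else κ.2 ⟨x, h⟩) ?_
        left_inv := ?_
        right_inv := ?_ }
    · intro x y hxy
      by_cases hx : x ∈ S
      · have hy := (hS x y hxy).1 hx
        simp only [hx, hy, dif_pos]
        exact κ.1.valid (by simpa using hxy)
      · have hy := (hS x y hxy).not.1 hx
        simp only [hx, hy, dif_neg, not_false_iff]
        exact κ.2.valid (by simpa using hxy)
    · intro κ
      ext x
      simp [SimpleGraph.Coloring.mk]
    · rintro ⟨κ₁, κ₂⟩
      ext x
      · simp [SimpleGraph.Coloring.mk]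
      · have := x.2
        simp only [Set.mem_compl_iff] at this
        simp [SimpleGraph.Coloring.mk, this]
  rw [hpqr, Polynomial.mul_coeff_one, chromatic_polynomial_coeff_zero hq,
    chromatic_polynomial_coeff_zero hr]
  simp

/-- The number of proper colourings of a path whose first vertex must avoid the colour `c`. -/
theorem card_ray_colorings {m : ℕ} (l : ℕ) (c : Fin m) :
    Nat.card {f : Fin l → Fin m // (∀ k : Fin l, (k : ℕ) = 0 → c ≠ f k) ∧
      ∀ k k' : Fin l, (k' : ℕ) = (k : ℕ) + 1 → f k ≠ f k'} = (m - 1) ^ l := by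
  induction l generalizing c with
  | zero =>
    rw [pow_zero, Nat.card_eq_one_iff_unique]
    exact ⟨⟨fun f g => Subtype.ext (Subsingleton.elim _ _)⟩,
      ⟨⟨Fin.elim0, fun k => k.elim0, fun k => k.elim0⟩⟩⟩
  | succ l ih =>
    have e : {f : Fin (l + 1) → Fin m // (∀ k : Fin (l + 1), (k : ℕ) = 0 → c ≠ f k) ∧
        ∀ k k' : Fin (l + 1), (k' : ℕ) = (k : ℕ) + 1 → f k ≠ f k'} ≃
        (x : {x : Fin m // x ≠ c}) × {f : Fin l → Fin m //
          (∀ k : Fin l, (k : ℕ) = 0 → x.1 ≠ f k) ∧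
          ∀ k k' : Fin l, (k' : ℕ) = (k : ℕ) + 1 → f k ≠ f k'} :=
      { toFun := fun f => ⟨⟨f.1 0, (f.2.1 0 rfl).symm⟩, fun k => f.1 k.succ,
          fun k hk => f.2.2 0 k.succ (by simp [hk]),
          fun k k' h => f.2.2 k.succ k'.succ (by simp [h])⟩
        invFun := fun x => ⟨Fin.cons x.1.1 x.2.1, by
          refine ⟨fun k => ?_, fun k k' => ?_⟩
          · cases k using Fin.cases with
            | zero => exact fun _ => x.1.2.symm
            | succ k => simp
          · cases k using Fin.cases with
            | zero =>
              cases k' using Fin.cases with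
              | zero => simp
              | succ k' => exact fun h => x.2.2.1 k' (by simpa using h)
            | succ k =>
              cases k' using Fin.cases with
              | zero => simp
              | succ k' => exact fun h => x.2.2.2 k k' (by simpa using h)⟩
        left_inv := fun f => Subtype.ext (Fin.cons_self_tail f.1)
        right_inv := fun x => rfl }
    rw [Nat.card_congr e, Nat.card_sigma]
    simp only [ih]
    simp [pow_succ', Fintype.card_subtype_compl]

/-- A proper colouring of a sun with triangular body is an injective colouring of the body
together with a proper colouring of each ray. -/
def sunColoringEquiv (lam : Fin 3 → ℕ) (m : ℕ) :
    (sunGraph 3 lam).Coloring (Fin m) ≃ (β : Fin 3 ↪ Fin m) × ((i : Fin 3) →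
      {f : Fin (lam i) → Fin m // (∀ k : Fin (lam i), (k : ℕ) = 0 → β i ≠ f k) ∧
        ∀ k k' : Fin (lam i), (k' : ℕ) = (k : ℕ) + 1 → f k ≠ f k'}) where
  toFun κ := ⟨⟨fun i => κ (Sum.inl i), fun i j h => by
      by_contra hij
      refine κ.valid (v := Sum.inl i) (w := Sum.inl j) ?_ h
      rw [sunGraph, SimpleGraph.fromRel_adj]
      refine ⟨by simpa using hij, ?_⟩
      simp only [sunRel]
      omega⟩,
    fun i => ⟨fun k => κ (Sum.inr ⟨i, k⟩), fun k hk => κ.valid (by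
        rw [sunGraph, SimpleGraph.fromRel_adj]
        exact ⟨by simp, Or.inl ⟨rfl, hk⟩⟩),
      fun k k' h => κ.valid (by
        rw [sunGraph, SimpleGraph.fromRel_adj]
        refine ⟨fun h' => ?_, Or.inl ⟨rfl, h⟩⟩
        have hkk : k = k' := by simpa using h'
        subst hkk
        omega)⟩⟩
  invFun x := SimpleGraph.Coloring.mk (Sum.elim x.1 fun q => (x.2 q.1).1 q.2) (by
    have key : ∀ u v, u ≠ v → sunRel 3 lam (fun i i' => (i' : ℕ) = ((i : ℕ) + 1) % 3) u v →
        Sum.elim x.1 (fun q => (x.2 q.1).1 q.2) u ≠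
          Sum.elim x.1 (fun q => (x.2 q.1).1 q.2) v := by
      rintro (i | ⟨i, k⟩) (j | ⟨j, k'⟩) hne h
      · simpa using hne
      · obtain ⟨rfl, h⟩ := h
        exact (x.2 j).2.1 k' h
      · exact h.elim
      · obtain ⟨hij, h⟩ := h
        dsimp only at hij
        subst hij
        exact (x.2 i).2.2 k k' h
    intro u v huv
    rw [sunGraph, SimpleGraph.fromRel_adj] at huv
    obtain ⟨hne, h | h⟩ := huv
    · exact key u v hne h
    · exact (key v u hne.symm h).symm)
  left_inv κ := by
    ext (i | ⟨i, k⟩) <;> rfl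
  right_inv x := rfl

theorem card_sunColoring (lam : Fin 3 → ℕ) (m : ℕ) :
    Nat.card ((sunGraph 3 lam).Coloring (Fin m)) =
      m.descFactorial 3 * (m - 1) ^ ∑ i, lam i := by
  rw [Nat.card_congr (sunColoringEquiv lam m), Nat.card_sigma]
  simp only [Nat.card_pi, card_ray_colorings, Finset.prod_pow_eq_pow_sum]
  simp [Fintype.card_embedding_eq]

theorem sun_chromatic_polynomial_coeff_one {lam : Fin 3 → ℕ} {p : Polynomial ℚ}
    (hp : ∀ m : ℕ, p.eval (-(m : ℚ)) = Nat.card ((sunGraph 3 lam).Coloring (Fin m))) :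
    p.coeff 1 ≠ 0 := by
  open Polynomial in
  have : p = X * ((-1) * (-X - 1) * (-X - 2) * (-X - 1) ^ ∑ i, lam i) := by
    refine polynomial_eq_of_eval_neg_natCast fun m => ?_
    rw [hp, card_sunColoring]
    rcases m with _ | m
    · simp [Nat.descFactorial]
    · rcases m with _ | m
      · simp [Nat.descFactorial]
      · simp [Nat.descFactorial]
        ring
  rw [this, Polynomial.coeff_X_mul, Polynomial.coeff_zero_eq_eval_zero]
  simp

/-- Monomials in the first `m + n` variables of degree `e 0` in the first `m` variables and of
degree `e 1` in the next `n`. -/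
def bidegreeMonomials (m n : ℕ) (e : Fin 2 →₀ ℕ) : Finset (ℕ →₀ ℕ) :=
  ((Finset.range (m + n)).finsuppAntidiag (e 0 + e 1)).filter
    fun d => ∑ i ∈ Finset.range m, d i = e 0

/-- The substitution of `-u` for the first `m` variables, `-v` for the next `n`, and `0` for
the remaining ones. -/
noncomputable def blockVar (m n : ℕ) (i : ℕ) : MvPowerSeries (Fin 2) ℚ :=
  if i < m then -MvPowerSeries.X 0 else if i < m + n then -MvPowerSeries.X 1 else 0

theorem hasSubst_blockVar (m n : ℕ) : MvPowerSeries.HasSubst (blockVar m n) where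
  const_coeff s := by
    unfold blockVar
    split_ifs <;> simp
  coeff_zero d := by
    refine (Finset.finite_toSet (Finset.range (m + n))).subset fun i hi => ?_
    by_contra h
    have h : ¬ i < m + n := by simpa using h
    have h' : ¬ i < m := by omega
    exact hi (by simp [blockVar, h, h'])

theorem mem_bidegreeMonomials {m n : ℕ} {e : Fin 2 →₀ ℕ} {d : ℕ →₀ ℕ} :
    d ∈ bidegreeMonomials m n e ↔ d.support ⊆ Finset.range (m + n) ∧
      ∑ i ∈ Finset.range m, d i = e 0 ∧ ∑ i ∈ Finset.range n, d (m + i) = e 1 := by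
  rw [bidegreeMonomials, Finset.mem_filter, Finset.mem_finsuppAntidiag, Finset.sum_range_add]
  constructor
  · rintro ⟨⟨h₁, h₂⟩, h₃⟩
    exact ⟨h₂, h₃, by omega⟩
  · rintro ⟨h₂, h₃, h₄⟩
    exact ⟨⟨by omega, h₂⟩, h₃⟩

theorem coeff_prod_blockVar (m n : ℕ) (e : Fin 2 →₀ ℕ) (d : ℕ →₀ ℕ) :
    MvPowerSeries.coeff e (d.prod fun i k => blockVar m n i ^ k) =
      if d ∈ bidegreeMonomials m n e then (-1) ^ (e 0 + e 1) else 0 := by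
  by_cases hd : d.support ⊆ Finset.range (m + n)
  · have hprod : (d.prod fun i k => blockVar m n i ^ k) =
        MvPowerSeries.monomial (Finsupp.single 0 (∑ i ∈ Finset.range m, d i) +
          Finsupp.single 1 (∑ i ∈ Finset.range n, d (m + i)))
          ((-1) ^ (∑ i ∈ Finset.range m, d i + ∑ i ∈ Finset.range n, d (m + i))) := by
      rw [Finsupp.prod_of_support_subset d hd _ (by simp), Finset.prod_range_add,
        Finset.prod_congr rfl (g := fun i => (-MvPowerSeries.X 0) ^ d i)
          (fun i hi => by rw [blockVar, if_pos (Finset.mem_range.1 hi)]),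
        Finset.prod_congr (s₁ := Finset.range n) rfl
          (g := fun i => (-MvPowerSeries.X 1) ^ d (m + i))
          (fun i hi => by
            have := Finset.mem_range.1 hi
            rw [blockVar, if_neg (by omega), if_pos (by omega)]),
        Finset.prod_pow_eq_pow_sum, Finset.prod_pow_eq_pow_sum, neg_pow,
        neg_pow (_ : MvPowerSeries _ _) (∑ i ∈ Finset.range n, d (m + i)),
        MvPowerSeries.X_pow_eq, MvPowerSeries.X_pow_eq, mul_mul_mul_comm,
        MvPowerSeries.monomial_mul_monomial, ← pow_add, ← map_one MvPowerSeries.C, ← map_neg,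
        ← map_pow, ← MvPowerSeries.monomial_zero_eq_C_apply, MvPowerSeries.monomial_mul_monomial]
      simp
    rw [hprod, MvPowerSeries.coeff_monomial]
    have hiff : e = Finsupp.single 0 (∑ i ∈ Finset.range m, d i) +
        Finsupp.single 1 (∑ i ∈ Finset.range n, d (m + i)) ↔ d ∈ bidegreeMonomials m n e := by
      rw [mem_bidegreeMonomials, Finsupp.ext_iff, Fin.forall_fin_two]
      simp [hd, eq_comm]
    by_cases h : d ∈ bidegreeMonomials m n e
    · rw [if_pos (hiff.2 h), if_pos h]
      obtain ⟨-, h₁, h₂⟩ := mem_bidegreeMonomials.1 h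
      rw [h₁, h₂]
    · rw [if_neg (hiff.not.2 h), if_neg h]
  · rw [if_neg fun h => hd (mem_bidegreeMonomials.1 h).1]
    obtain ⟨i, hi, him⟩ := Finset.not_subset.1 hd
    have him : ¬ i < m + n := by simpa using him
    have him' : ¬ i < m := by omega
    rw [Finsupp.prod, Finset.prod_eq_zero hi, map_zero]
    rw [blockVar, if_neg him', if_neg him, zero_pow (Finsupp.mem_support_iff.1 hi)]

theorem coeff_subst_blockVar (m n : ℕ) (e : Fin 2 →₀ ℕ) (f : MvPowerSeries ℕ ℚ) :
    MvPowerSeries.coeff e (MvPowerSeries.subst (blockVar m n) f) =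
      (-1) ^ (e 0 + e 1) * ∑ d ∈ bidegreeMonomials m n e, MvPowerSeries.coeff d f := by
  rw [MvPowerSeries.coeff_subst (hasSubst_blockVar m n),
    finsum_eq_sum_of_support_subset (s := bidegreeMonomials m n e), Finset.mul_sum]
  · refine Finset.sum_congr rfl fun d hd => ?_
    rw [coeff_prod_blockVar, if_pos hd, smul_eq_mul, mul_comm]
  · intro d hd
    by_contra h
    rw [Finset.mem_coe] at h
    rw [Function.mem_support, coeff_prod_blockVar, if_neg h] at hd
    simp at hd

/-- The number of squarefree monomials of a given bidegree. -/
theorem sum_esym_bidegreeMonomials (m n k : ℕ) (e : Fin 2 →₀ ℕ) :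
    ∑ d ∈ bidegreeMonomials m n e, esym k d =
      if e 0 + e 1 = k then (m.choose (e 0) : ℚ) * n.choose (e 1) else 0 := by
  classical
  have hsum : ∀ d ∈ bidegreeMonomials m n e, (d.sum fun _ v => v) = e 0 + e 1 := by
    intro d hd
    rw [bidegreeMonomials, Finset.mem_filter, Finset.mem_finsuppAntidiag] at hd
    rw [Finsupp.sum_of_support_subset d hd.1.2 _ (by simp), hd.1.1]
  split_ifs with hk
  · have hcard : ((bidegreeMonomials m n e).filter fun d => ∀ i ∈ d.support, d i = 1).card =
        (Finset.powersetCard (e 0) (Finset.range m) ×ˢ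
          Finset.powersetCard (e 1) (Finset.range n)).card := by
      have hmem : ∀ d : ℕ →₀ ℕ, (∀ i ∈ d.support, d i = 1) →
          ∀ i, d i = if d i ≠ 0 then 1 else 0 := by
        intro d hd i
        split_ifs with h
        · exact hd i (Finsupp.mem_support_iff.2 h)
        · simpa using h
      let ind : Finset ℕ × Finset ℕ → ℕ →₀ ℕ := fun x =>
        Finsupp.indicator (x.1 ∪ x.2.map (addLeftEmbedding m)) fun _ _ => 1
      have hind : ∀ x i, ind x i = if i ∈ x.1 ∨ ∃ j ∈ x.2, m + j = i then 1 else 0 := by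
        intro x i
        simp [ind, Finsupp.indicator_apply]
      have hleft : ∀ x i, i < m → ind x i = if i ∈ x.1 then 1 else 0 := by
        intro x i hi
        have : ¬ ∃ j ∈ x.2, m + j = i := by rintro ⟨j, -, rfl⟩; omega
        rw [hind]
        simp only [this, or_false]
      have hright : ∀ x i, x.1 ⊆ Finset.range m → ind x (m + i) = if i ∈ x.2 then 1 else 0 := by
        intro x i hx
        have : m + i ∉ x.1 := fun h => by simpa using hx h
        rw [hind]
        simp [this]
      refine Finset.card_bij'
        (fun d _ => ((Finset.range m).filter fun i => d i ≠ 0,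
          (Finset.range n).filter fun i => d (m + i) ≠ 0)) (fun x _ => ind x) ?_ ?_ ?_ ?_
      · intro d hd
        obtain ⟨hd, h01⟩ := Finset.mem_filter.1 hd
        obtain ⟨-, h₁, h₂⟩ := mem_bidegreeMonomials.1 hd
        simp only [Finset.mem_product, Finset.mem_powersetCard, Finset.filter_subset, true_and,
          Finset.card_filter, ← hmem d h01, h₁, h₂]
      · intro x hx
        simp only [Finset.mem_product, Finset.mem_powersetCard] at hx
        obtain ⟨⟨hS, hS'⟩, hT, hT'⟩ := hx
        refine Finset.mem_filter.2 ⟨mem_bidegreeMonomials.2 ⟨?_, ?_, ?_⟩, ?_⟩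
        · intro i hi
          rw [Finsupp.mem_support_iff, hind, ne_eq, ite_eq_right_iff, Classical.not_imp] at hi
          rcases hi.1 with h | ⟨j, hj, rfl⟩
          · have := Finset.mem_range.1 (hS h)
            exact Finset.mem_range.2 (by omega)
          · have := Finset.mem_range.1 (hT hj)
            exact Finset.mem_range.2 (by omega)
        · rw [Finset.sum_congr rfl fun i hi => hleft x i (Finset.mem_range.1 hi)]
          simp [Finset.inter_eq_right.2 hS, hS']
        · rw [Finset.sum_congr rfl fun i hi => hright x i hS]
          simp [Finset.inter_eq_right.2 hT, hT']
        · intro i hi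
          rw [Finsupp.mem_support_iff, hind] at hi
          rw [hind]
          simpa using hi
      · intro d hd
        obtain ⟨hd, h01⟩ := Finset.mem_filter.1 hd
        obtain ⟨hsupp, -, -⟩ := mem_bidegreeMonomials.1 hd
        ext i
        rw [hmem d h01 i]
        by_cases him : i < m
        · rw [hleft _ _ him]
          simp [him]
        · obtain ⟨j, rfl⟩ := Nat.exists_eq_add_of_le (not_lt.1 him)
          rw [hright _ _ (Finset.filter_subset _ _)]
          have : d (m + j) ≠ 0 → j < n := fun h => by
            simpa using hsupp (Finsupp.mem_support_iff.2 h)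
          simp only [Finset.mem_filter, Finset.mem_range]
          congr 1
          simpa using this
      · intro x hx
        simp only [Finset.mem_product, Finset.mem_powersetCard] at hx
        obtain ⟨⟨hS, -⟩, hT, -⟩ := hx
        ext i
        · simp only [Finset.mem_filter, Finset.mem_range]
          constructor
          · rintro ⟨h, h'⟩
            simpa [hleft x i h] using h'
          · intro h
            have hi := Finset.mem_range.1 (hS h)
            exact ⟨hi, by simp [hleft x i hi, h]⟩
        · simp only [Finset.mem_filter, Finset.mem_range, hright x i hS]
          constructor
          · rintro ⟨-, h'⟩
            simpa using h'
          · intro h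
            exact ⟨Finset.mem_range.1 (hT h), by simp [h]⟩
    rw [Finset.card_product, Finset.card_powersetCard, Finset.card_powersetCard,
      Finset.card_range, Finset.card_range] at hcard
    rw [← Nat.cast_mul, ← hcard, Finset.card_filter]
    push_cast
    refine Finset.sum_congr rfl fun d hd => ?_
    simp [esym, hsum d hd, hk]
  · refine Finset.sum_eq_zero fun d hd => ?_
    rw [esym, if_neg]
    rw [hsum d hd]
    exact fun h => hk h.2

/-- The polynomial `x (x + 1) ⋯ (x + k - 1) / k!`. -/
noncomputable def risingBinomial (k : ℕ) : Polynomial ℚ :=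
  Polynomial.C ((k.factorial : ℚ)⁻¹) * ascPochhammer ℚ k

theorem risingBinomial_eval_neg (k m : ℕ) :
    (risingBinomial k).eval (-(m : ℚ)) = (-1) ^ k * m.choose k := by
  have : (k.factorial : ℚ) ≠ 0 := by exact_mod_cast k.factorial_ne_zero
  rw [risingBinomial, Polynomial.eval_mul, Polynomial.eval_C,
    ascPochhammer_eval_neg_eq_descPochhammer, descPochhammer_eval_eq_descFactorial,
    Nat.descFactorial_eq_factorial_mul_choose]
  push_cast
  field_simp

theorem risingBinomial_coeff_nonneg (k i : ℕ) : 0 ≤ (risingBinomial k).coeff i := by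
  rw [risingBinomial, Polynomial.coeff_C_mul, ← ascPochhammer_map (Nat.castRingHom ℚ),
    Polynomial.coeff_map]
  simp only [eq_natCast]
  positivity

theorem risingBinomial_zero : risingBinomial 0 = 1 := by
  simp [risingBinomial]

theorem risingBinomial_coeff_zero {k : ℕ} (hk : 0 < k) : (risingBinomial k).coeff 0 = 0 := by
  rw [Polynomial.coeff_zero_eq_eval_zero, ← neg_zero, ← Nat.cast_zero, risingBinomial_eval_neg,
    Nat.choose_eq_zero_of_lt hk]
  simp

theorem risingBinomial_coeff_one {k : ℕ} (hk : 0 < k) : 0 < (risingBinomial k).coeff 1 := by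
  obtain ⟨k, rfl⟩ := Nat.exists_eq_succ_of_ne_zero hk.ne'
  rw [risingBinomial, Polynomial.coeff_C_mul, ascPochhammer_succ_left, Polynomial.coeff_X_mul,
    Polynomial.coeff_zero_eq_eval_zero, Polynomial.eval_comp]
  have := ascPochhammer_pos k (1 : ℚ) one_pos
  simp only [Polynomial.eval_add, Polynomial.eval_X, Polynomial.eval_one, zero_add]
  positivity

/-- The image of `esym k` under the block substitution, as a power series whose coefficients
are polynomials in the negated block sizes. -/
noncomputable def genericEsym (k : ℕ) : MvPowerSeries (Fin 2) (Polynomial (Polynomial ℚ)) :=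
  fun e => if e 0 + e 1 = k then
    Polynomial.C (risingBinomial (e 0)) * (risingBinomial (e 1)).map Polynomial.C else 0

theorem coeff_genericEsym (k : ℕ) (e : Fin 2 →₀ ℕ) :
    MvPowerSeries.coeff e (genericEsym k) = if e 0 + e 1 = k then
      Polynomial.C (risingBinomial (e 0)) * (risingBinomial (e 1)).map Polynomial.C else 0 :=
  rfl

theorem coeff_coeff_C_mul_map_C (p q : Polynomial ℚ) (i j : ℕ) :
    ((Polynomial.C p * q.map Polynomial.C).coeff j).coeff i = p.coeff i * q.coeff j := by
  simp [Polynomial.coeff_C_mul]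

theorem evalEval_C_mul_map_C (p q : Polynomial ℚ) (x y : ℚ) :
    (Polynomial.C p * q.map Polynomial.C).evalEval x y = p.eval x * q.eval y := by
  rw [Polynomial.evalEval_mul, Polynomial.evalEval_map_C, Polynomial.evalEval_C]

theorem subst_blockVar_esym (m n k : ℕ) :
    MvPowerSeries.subst (blockVar m n) (esym k) =
      MvPowerSeries.map (Polynomial.evalEvalRingHom (-(m : ℚ)) (-(n : ℚ))) (genericEsym k) := by
  ext e
  rw [coeff_subst_blockVar, MvPowerSeries.coeff_map, coeff_genericEsym]
  refine (congrArg _ (sum_esym_bidegreeMonomials m n k e)).trans ?_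
  split_ifs
  · rw [Polynomial.coe_evalEvalRingHom, evalEval_C_mul_map_C, risingBinomial_eval_neg,
      risingBinomial_eval_neg]
    ring
  · simp

theorem subst_blockVar_esymM (m n : ℕ) (μ : Multiset ℕ) :
    MvPowerSeries.subst (blockVar m n) (esymM μ) =
      MvPowerSeries.map (Polynomial.evalEvalRingHom (-(m : ℚ)) (-(n : ℚ)))
        (μ.map genericEsym).prod := by
  rw [esymM, ← MvPowerSeries.coe_substAlgHom (hasSubst_blockVar m n), map_multiset_prod,
    map_multiset_prod, Multiset.map_map, Multiset.map_map]
  simp only [Function.comp_def, MvPowerSeries.coe_substAlgHom, subst_blockVar_esym]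

theorem genericEsym_prod_coeff_nonneg (μ : Multiset ℕ) (e : Fin 2 →₀ ℕ) (i j : ℕ) :
    0 ≤ ((MvPowerSeries.coeff e (μ.map genericEsym).prod).coeff j).coeff i := by
  classical
  induction μ using Multiset.induction_on generalizing e i j with
  | empty =>
    rw [Multiset.map_zero, Multiset.prod_zero, MvPowerSeries.coeff_one]
    split_ifs
    · rw [Polynomial.coeff_one]
      split_ifs
      · rw [Polynomial.coeff_one]
        split_ifs <;> simp
      · simp
    · simp
  | cons k μ ih =>
    rw [Multiset.map_cons, Multiset.prod_cons, MvPowerSeries.coeff_mul]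
    simp only [Polynomial.finsetSum_coeff, Polynomial.coeff_mul]
    refine Finset.sum_nonneg fun _ _ => Finset.sum_nonneg fun _ _ => Finset.sum_nonneg fun _ _ =>
      mul_nonneg ?_ (ih _ _ _)
    rw [coeff_genericEsym]
    split_ifs
    · rw [coeff_coeff_C_mul_map_C]
      exact mul_nonneg (risingBinomial_coeff_nonneg _ _) (risingBinomial_coeff_nonneg _ _)
    · simp

theorem genericEsym_coeff_zero {k : ℕ} (hk : k ≠ 0) (e : Fin 2 →₀ ℕ) :
    ((MvPowerSeries.coeff e (genericEsym k)).coeff 0).coeff 0 = 0 := by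
  rw [coeff_genericEsym]
  split_ifs with h
  · rw [coeff_coeff_C_mul_map_C]
    rcases Nat.eq_zero_or_pos (e 0) with h0 | h0
    · rw [risingBinomial_coeff_zero (k := e 1) (by omega), mul_zero]
    · rw [risingBinomial_coeff_zero h0, zero_mul]
  · simp

/-- Only `e_N` contributes to the linear term in degree `N`. -/
theorem genericEsym_prod_coeff_one_zero {μ : Multiset ℕ} (hμ : 0 ∉ μ) {e : Fin 2 →₀ ℕ}
    (he : e ≠ 0) (hμe : μ ≠ {e 0 + e 1}) :
    ((MvPowerSeries.coeff e (μ.map genericEsym).prod).coeff 0).coeff 1 = 0 := by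
  classical
  induction μ using Multiset.induction_on with
  | empty => simp [MvPowerSeries.coeff_one, he]
  | cons k μ =>
    induction μ using Multiset.induction_on with
    | empty =>
      have hk : e 0 + e 1 ≠ k := fun h => hμe (by simp [h])
      simp [coeff_genericEsym, hk]
    | cons l μ =>
      have hk : k ≠ 0 := fun h => hμ (by simp [h])
      have hl : l ≠ 0 := fun h => hμ (by simp [h])
      rw [Multiset.map_cons, Multiset.map_cons, Multiset.prod_cons, Multiset.prod_cons,
        ← mul_assoc]
      simp [MvPowerSeries.coeff_mul, Polynomial.mul_coeff_zero, Polynomial.mul_coeff_one,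
        genericEsym_coeff_zero hk, genericEsym_coeff_zero hl]

theorem card_eq_sum_card_fiber {α β : Type} [Finite α] (φ : α → β) (D : Finset β)
    (h : ∀ x, φ x ∈ D) : Nat.card α = ∑ d ∈ D, Nat.card {x // φ x = d} := by
  rw [← Nat.card_congr (Equiv.sigmaFiberEquiv fun x => (⟨φ x, h x⟩ : D)), Nat.card_sigma]
  simp only [Subtype.ext_iff]
  exact Finset.sum_coe_sort D fun d => Nat.card {x // φ x = d}

/-- Proper colourings with `m + n` colours, the first `m` of which are used `a` times. -/
def BlockColoring {V : Type} [Fintype V] (G : SimpleGraph V) (m n a : ℕ) : Type :=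
  {κ : V → ℕ // (∀ u v : V, G.Adj u v → κ u ≠ κ v) ∧ (∀ v, κ v < m + n) ∧
    (Finset.univ.filter fun v => κ v < m).card = a}

instance {V : Type} [Fintype V] (G : SimpleGraph V) (m n a : ℕ) :
    Finite (BlockColoring G m n a) :=
  Finite.of_injective (β := V → Fin (m + n)) (fun κ v => ⟨κ.1 v, κ.2.2.1 v⟩) fun κ κ' h =>
    Subtype.ext (funext fun v => by simpa using congrFun h v)

theorem natCard_color_eq_sum {V : Type} [Fintype V] (κ : V → ℕ) (i : ℕ) :
    Nat.card {v : V // κ v = i} = ∑ v, if κ v = i then 1 else 0 := by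
  rw [Nat.card_eq_fintype_card, Fintype.card_subtype, Finset.card_filter]

theorem sum_csf_bidegreeMonomials {V : Type} [Fintype V] (G : SimpleGraph V) (m n : ℕ)
    {e : Fin 2 →₀ ℕ} (he : e 0 + e 1 = Fintype.card V) :
    ∑ d ∈ bidegreeMonomials m n e, csf G d = Nat.card (BlockColoring G m n (e 0)) := by
  classical
  let count (κ : V → ℕ) : ℕ →₀ ℕ := ∑ v, Finsupp.single (κ v) 1
  have hcount : ∀ κ i, count κ i = ∑ v, if κ v = i then 1 else 0 := by
    intro κ i
    simp [count, Finsupp.finsetSum_apply, Finsupp.single_apply]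
  have hfirst : ∀ κ : V → ℕ, ∑ i ∈ Finset.range m, count κ i =
      (Finset.univ.filter fun v => κ v < m).card := by
    intro κ
    simp only [hcount, Finset.card_filter]
    rw [Finset.sum_comm]
    simp
  have hmem : ∀ κ : V → ℕ, count κ ∈ bidegreeMonomials m n e ↔ (∀ v, κ v < m + n) ∧
      (Finset.univ.filter fun v => κ v < m).card = e 0 := by
    intro κ
    rw [bidegreeMonomials, Finset.mem_filter, Finset.mem_finsuppAntidiag, hfirst]
    refine and_congr_left fun _ => ⟨fun h v => ?_, fun h => ⟨?_, fun i hi => ?_⟩⟩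
    · refine Finset.mem_range.1 (h.2 (Finsupp.mem_support_iff.2 ?_))
      rw [hcount]
      refine (Finset.sum_pos' (fun _ _ => Nat.zero_le _) ⟨v, Finset.mem_univ v, by simp⟩).ne'
    · simp only [hcount]
      rw [Finset.sum_comm]
      simp [h, he]
    · rw [Finsupp.mem_support_iff, hcount] at hi
      obtain ⟨v, -, hv⟩ := Finset.exists_ne_zero_of_sum_ne_zero hi
      have : κ v = i := by simpa using hv
      exact Finset.mem_range.2 (this ▸ h v)
  rw [card_eq_sum_card_fiber (fun κ : BlockColoring G m n (e 0) => count κ.1)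
    (bidegreeMonomials m n e) fun κ => (hmem _).2 κ.2.2, Nat.cast_sum]
  refine Finset.sum_congr rfl fun d hd => ?_
  rw [csf, Nat.cast_inj]
  have hiff : ∀ κ : V → ℕ, (∀ i, Nat.card {v // κ v = i} = d i) ↔ count κ = d := by
    intro κ
    rw [Finsupp.ext_iff]
    simp only [hcount, natCard_color_eq_sum]
  exact Nat.card_congr
    { toFun := fun κ => ⟨⟨κ.1, κ.2.1, (hmem _).1 (((hiff κ.1).1 κ.2.2).symm ▸ hd)⟩,
        (hiff κ.1).1 κ.2.2⟩
      invFun := fun κ => ⟨κ.1.1, κ.1.2.1, (hiff _).2 κ.2⟩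
      left_inv := fun _ => rfl
      right_inv := fun _ => rfl }

theorem card_blockColoring {V : Type} [Fintype V] [DecidableEq V] (G : SimpleGraph V)
    (m n a : ℕ) :
    Nat.card (BlockColoring G m n a) = ∑ A ∈ Finset.powersetCard a (Finset.univ : Finset V),
      Nat.card ((G.induce (↑A : Set V)).Coloring (Fin m)) *
        Nat.card ((G.induce (↑Aᶜ : Set V)).Coloring (Fin n)) := by
  rw [card_eq_sum_card_fiber
    (fun κ : BlockColoring G m n a => Finset.univ.filter fun v => κ.1 v < m)
    (Finset.powersetCard a Finset.univ) fun κ => by simpa using κ.2.2.2]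
  refine Finset.sum_congr rfl fun A hA => ?_
  rw [← Nat.card_prod]
  have hlt : ∀ κ : {κ : BlockColoring G m n a // (Finset.univ.filter fun v => κ.1 v < m) = A},
      ∀ v, v ∈ A ↔ κ.1.1 v < m := by
    rintro ⟨κ, rfl⟩ v
    simp
  let ext (x : (G.induce (↑A : Set V)).Coloring (Fin m) ×
      (G.induce (↑Aᶜ : Set V)).Coloring (Fin n)) (v : V) : ℕ :=
    if h : v ∈ A then x.1 ⟨v, h⟩ else m + x.2 ⟨v, by simpa using h⟩
  have hext : ∀ x v, ext x v < m ↔ v ∈ A := by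
    intro x v
    by_cases h : v ∈ A <;> simp [ext, h]
  have hfilter : ∀ x, (Finset.univ.filter fun v => ext x v < m) = A := by
    intro x
    ext v
    simp [hext]
  refine Nat.card_congr
    { toFun := fun κ =>
        (SimpleGraph.Coloring.mk (fun v => ⟨κ.1.1 v, (hlt κ v).1 v.2⟩) fun {u v} h h' =>
            κ.1.2.1 u v h (by simpa using h'),
          SimpleGraph.Coloring.mk (fun v => ⟨κ.1.1 v - m, by
            have := κ.1.2.2.1 v
            have := (hlt κ v).not.1 (by simpa using v.2)
            omega⟩) fun {u v} h h' => κ.1.2.1 u v h (by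
              have := (hlt κ u).not.1 (by simpa using u.2)
              have := (hlt κ v).not.1 (by simpa using v.2)
              have := congrArg Fin.val h'
              dsimp only at this
              omega))
      invFun := fun x => ⟨⟨ext x, ?_, ?_, ?_⟩, hfilter x⟩
      left_inv := ?_
      right_inv := ?_ }
  · intro u v huv h
    have huv' : u ∈ A ↔ v ∈ A := by rw [← hext x, ← hext x, h]
    by_cases hu : u ∈ A
    · have hv := huv'.1 hu
      simp only [ext, hu, hv, dif_pos] at h
      exact x.1.valid (v := ⟨u, hu⟩) (w := ⟨v, hv⟩) huv (Fin.ext h)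
    · have hv := huv'.not.1 hu
      simp only [ext, hu, hv, dif_neg, not_false_iff] at h
      exact x.2.valid (v := ⟨u, by simpa using hu⟩) (w := ⟨v, by simpa using hv⟩) huv
        (Fin.ext (by omega))
  · intro v
    by_cases h : v ∈ A
    · simp only [ext, h, dif_pos]
      omega
    · simp only [ext, h, dif_neg, not_false_iff]
      omega
  · rw [hfilter]
    simpa using hA
  · intro κ
    refine Subtype.ext (Subtype.ext (funext fun v => ?_))
    by_cases h : v ∈ A
    · simp [ext, h, SimpleGraph.Coloring.mk]
    · have := (hlt κ v).not.1 h
      simp [ext, h, SimpleGraph.Coloring.mk]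
      omega
  · rintro ⟨x, y⟩
    refine Prod.ext (DFunLike.ext _ _ fun v => Fin.ext ?_) (DFunLike.ext _ _ fun v => Fin.ext ?_)
    · simp [ext, SimpleGraph.Coloring.mk]
    · have := v.2
      simp only [Finset.coe_compl, Set.mem_compl_iff, Finset.mem_coe] at this
      simp [ext, SimpleGraph.Coloring.mk, this]

/-- Comparison of the chromatic symmetric function with its expansion in elementary symmetric
functions, in a fixed bidegree and as polynomials in the negated block sizes. -/
theorem sum_chromatic_polynomial_eq {V : Type} [Fintype V] [DecidableEq V] {G : SimpleGraph V}
    {c : Multiset ℕ →₀ ℚ} (hc : csf G = c.sum fun μ a => a • esymM μ) {e : Fin 2 →₀ ℕ}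
    (he : e 0 + e 1 = Fintype.card V) {p : Finset V → Polynomial ℚ}
    (hp : ∀ A (m : ℕ), (p A).eval (-(m : ℚ)) =
      Nat.card ((G.induce (↑A : Set V)).Coloring (Fin m))) (i j : ℕ) :
    (-1) ^ Fintype.card V * ∑ A ∈ Finset.powersetCard (e 0) (Finset.univ : Finset V),
        (p A).coeff i * (p Aᶜ).coeff j =
      ∑ μ ∈ c.support, c μ *
        ((MvPowerSeries.coeff e (μ.map genericEsym).prod).coeff j).coeff i := by
  have key : Polynomial.C (Polynomial.C ((-1) ^ Fintype.card V)) *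
      ∑ A ∈ Finset.powersetCard (e 0) (Finset.univ : Finset V),
        Polynomial.C (p A) * (p Aᶜ).map Polynomial.C =
      ∑ μ ∈ c.support, Polynomial.C (Polynomial.C (c μ)) *
        MvPowerSeries.coeff e (μ.map genericEsym).prod := by
    refine bivariate_eq_of_eval_neg_natCast fun m n => ?_
    have hsum : ∑ d ∈ bidegreeMonomials m n e, MvPowerSeries.coeff d (csf G) =
        Nat.card (BlockColoring G m n (e 0)) := sum_csf_bidegreeMonomials G m n he
    have h := coeff_subst_blockVar m n e (csf G)
    rw [hsum, card_blockColoring, he] at h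
    change Polynomial.evalEvalRingHom _ _ _ = Polynomial.evalEvalRingHom _ _ _
    simp only [map_mul, map_sum]
    simp only [Polynomial.coe_evalEvalRingHom, Polynomial.evalEval_C, Polynomial.eval_C,
      Polynomial.evalEval_map_C, hp]
    push_cast at h
    rw [← h, hc, Finsupp.sum, ← MvPowerSeries.coe_substAlgHom (hasSubst_blockVar m n)]
    simp only [map_sum, map_smul]
    simp only [MvPowerSeries.coe_substAlgHom, subst_blockVar_esymM, MvPowerSeries.coeff_map,
      Polynomial.coe_evalEvalRingHom, smul_eq_mul]
  have h := congrArg (fun q => (Polynomial.coeff q j).coeff i) key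
  rw [Polynomial.coeff_C_mul, Polynomial.coeff_C_mul] at h
  simp only [Polynomial.finsetSum_coeff, coeff_coeff_C_mul_map_C] at h
  simpa only [Polynomial.coeff_C_mul] using h

/-- An `e`-positive graph without a connected partition of type `(a, b)` has a chromatic
polynomial without linear term. -/
theorem EPositive.chromatic_polynomial_coeff_one_eq_zero {V : Type} [Fintype V] [DecidableEq V]
    {G : SimpleGraph V} (hG : EPositive (csf G)) {a b : ℕ} (ha : 0 < a) (hb : 0 < b)
    (hab : a + b = Fintype.card V)
    (hno : ∀ A : Finset V, A.card = a → (G.induce (↑A : Set V)).Connected →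
      ¬ (G.induce (↑Aᶜ : Set V)).Connected) {q : Polynomial ℚ}
    (hq : ∀ m : ℕ, q.eval (-(m : ℚ)) = Nat.card (G.Coloring (Fin m))) :
    q.coeff 1 = 0 := by
  obtain ⟨c, hc₀, hcμ, hc⟩ := hG
  choose p hp using fun A : Finset V => exists_chromatic_polynomial (G.induce (↑A : Set V))
  have hcN : c {a + b} = 0 := by
    let e : Fin 2 →₀ ℕ := Finsupp.single 0 a + Finsupp.single 1 b
    have he₀ : e 0 = a := by simp [e]
    have he₁ : e 1 = b := by simp [e]
    have h := sum_chromatic_polynomial_eq hc (e := e) (by rw [he₀, he₁, hab]) hp 1 1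
    rw [Finset.sum_eq_zero, mul_zero, eq_comm,
      Finset.sum_eq_zero_iff_of_nonneg fun μ _ =>
        mul_nonneg (hc₀ μ) (genericEsym_prod_coeff_nonneg μ e 1 1)] at h
    · by_contra hne
      have h := h {a + b} (Finsupp.mem_support_iff.2 hne)
      rw [Multiset.map_singleton, Multiset.prod_singleton, coeff_genericEsym, he₀, he₁,
        if_pos rfl, coeff_coeff_C_mul_map_C] at h
      have := mul_pos (risingBinomial_coeff_one ha) (risingBinomial_coeff_one hb)
      rcases mul_eq_zero.1 h with h | h
      · exact hne h
      · exact this.ne' h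
    · intro A hA
      have hA : A.card = a := by simpa [he₀] using hA
      have hA' : Aᶜ.card = b := by rw [Finset.card_compl]; omega
      obtain ⟨x, hx⟩ := Finset.card_pos.1 (hA ▸ ha)
      obtain ⟨y, hy⟩ := Finset.card_pos.1 (hA' ▸ hb)
      by_cases hcon : (G.induce (↑A : Set V)).Connected
      · have : Nonempty (↑Aᶜ : Set V) := ⟨⟨y, hy⟩⟩
        rw [chromatic_polynomial_coeff_one (hno A hA hcon) (hp _), mul_zero]
      · have : Nonempty (↑A : Set V) := ⟨⟨x, hx⟩⟩
        rw [chromatic_polynomial_coeff_one hcon (hp _), zero_mul]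
  let e : Fin 2 →₀ ℕ := Finsupp.single 0 (a + b)
  have he₀ : e 0 = a + b := by simp [e]
  have he₁ : e 1 = 0 := by simp [e]
  have h := sum_chromatic_polynomial_eq hc (e := e) (by rw [he₀, he₁, add_zero, hab]) hp 1 0
  have huniv : p Finset.univ = q := by
    refine polynomial_eq_of_eval_neg_natCast fun m => ?_
    rw [hp, hq, Nat.cast_inj]
    exact Nat.card_congr
      { toFun := fun κ => SimpleGraph.Coloring.mk (fun v => κ ⟨v, by simp⟩) fun h => κ.valid h
        invFun := fun κ => SimpleGraph.Coloring.mk (fun v => κ v) fun h => κ.valid h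
        left_inv := fun _ => rfl
        right_inv := fun _ => rfl }
  have hempty : (p Finset.univᶜ).coeff 0 = 1 := by
    rw [Polynomial.coeff_zero_eq_eval_zero, ← neg_zero, ← Nat.cast_zero, hp]
    have : IsEmpty (↑(Finset.univᶜ : Finset V) : Set V) := by simp
    rw [Nat.cast_eq_one, Nat.card_eq_one_iff_unique]
    exact ⟨⟨fun κ κ' => DFunLike.ext _ _ fun v => isEmptyElim v⟩,
      ⟨SimpleGraph.Coloring.mk (fun v => isEmptyElim v) fun {v} => isEmptyElim v⟩⟩
  rw [he₀, hab, ← Finset.card_univ, Finset.powersetCard_self, Finset.sum_singleton, huniv,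
    hempty, mul_one, Finset.sum_eq_zero] at h
  · simpa using h
  · intro μ hμ
    rw [genericEsym_prod_coeff_one_zero (hcμ μ hμ), mul_zero]
    · intro h0
      rw [h0] at he₀
      simp at he₀
      omega
    · rintro rfl
      rw [he₀, he₁, add_zero] at hμ
      exact Finsupp.mem_support_iff.1 hμ hcN

/-- If `λ_1 = max{λ_1, λ_2, λ_3}` and `λ_1 < λ_2 + λ_3`, then the sun
`S(3; λ_1, λ_2, λ_3)` has no connected partition of type `(λ_2 + λ_3 + 1, λ_1 + 2)`,
hence is not `e`-positive. -/
theorem sun3_not_ePositive (l₁ l₂ l₃ : ℕ) (h₁ : 0 < l₁) (h₂ : 0 < l₂) (h₃ : 0 < l₃)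
    (hmax₂ : l₂ ≤ l₁) (hmax₃ : l₃ ≤ l₁) (hlt : l₁ < l₂ + l₃) :
    ¬ HasConnectedPartition (sunGraph 3 ![l₁, l₂, l₃]) {l₂ + l₃ + 1, l₁ + 2} ∧
    ¬ EPositive (csf (sunGraph 3 ![l₁, l₂, l₃])) := by
  have hno : ∀ A : Finset (Fin 3 ⊕ ((i : Fin 3) × Fin (![l₁, l₂, l₃] i))),
      A.card = l₂ + l₃ + 1 → Aᶜ.card = l₁ + 2 →
      ((sunGraph 3 ![l₁, l₂, l₃]).induce (↑A : Set _)).Connected →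
      ¬ ((sunGraph 3 ![l₁, l₂, l₃]).induce (↑Aᶜ : Set _)).Connected :=
    fun A hA hA' hcon hcon' =>
      sun3_no_connected_compl h₂ h₃ hmax₂ hmax₃ hlt hA hA' hcon hcon'
  refine ⟨fun h => ?_, fun h => ?_⟩
  · obtain ⟨A, hA, hA', hcon, hcon'⟩ := h.exists_compl
    exact hno A hA hA' hcon hcon'
  · obtain ⟨q, hq⟩ := exists_chromatic_polynomial (sunGraph 3 ![l₁, l₂, l₃])
    have hcard : l₂ + l₃ + 1 + (l₁ + 2) =
        Fintype.card (Fin 3 ⊕ ((i : Fin 3) × Fin (![l₁, l₂, l₃] i))) := by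
      simp [Fin.sum_univ_three]
      omega
    refine sun_chromatic_polynomial_coeff_one hq
      (h.chromatic_polynomial_coeff_one_eq_zero (Nat.succ_pos _) (Nat.succ_pos _) hcard
        (fun A hA => hno A hA ?_) hq)
    rw [Finset.card_compl]
    omega
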